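/- arXiv:1402.5063 — 2 statements merged into one kernel-verified Lean document; each statement's English description precedes it below -/
import Mathlib

section
/- For every integer k ≥ 2, let n = 2k−1 and let ε ∈ ℚⁿ be the vector with ε_j = 1 if j is even and ε_j = 0 if j is odd. Then the vector d ∈ ℚⁿ with entries d_{2i−1} = 2(k−i)(i−1) + k − 1 for 1 ≤ i ≤ k and d_{2i} = 2i(k−i) for 1 ≤ i ≤ k−1 satisfies C·d = 2·ε, where C is the Cartan matrix of type A_{2k−1}; equivalently d = 2·C⁻¹·ε. Thus d is the vector of degrees of the Iwasawa polynomials of the symmetric space SU*(2k)/USp(2k) in the fundamental representations. -/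
open Matrix

/-- The Cartan matrix of type `Aₙ`. -/
def cartanA (n : ℕ) : Matrix (Fin n) (Fin n) ℚ :=
  Matrix.of fun i j =>
    if i = j then 2
    else if i.val + 1 = j.val ∨ j.val + 1 = i.val then -1
    else 0

/-- The Satake vector of `SU*(2k)/USp(2k)` (type AII): `εⱼ = 1` for `j` even,
`εⱼ = 0` for `j` odd (1-based indices as `Fin (2k-1)`). -/
def satakeAII (n : ℕ) : Fin n → ℚ :=
  fun m => if (m.val + 1) % 2 = 0 then 1 else 0

/-- The degrees of the Iwasawa polynomials of `SU*(2k)/USp(2k)` in the fundamental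
representations: `d_{2i-1} = 2(k-i)(i-1) + k - 1` (`1 ≤ i ≤ k`) and
`d_{2i} = 2i(k-i)` (`1 ≤ i ≤ k-1`). -/
def degSUstar (k n : ℕ) : Fin n → ℚ :=
  fun m =>
    if m.val % 2 = 0 then
      -- 1-based index `m+1 = 2i-1` is odd, with `i = m/2 + 1`
      2 * ((k : ℚ) - ((m.val / 2 : ℕ) + 1)) * (((m.val / 2 : ℕ) + 1 : ℚ) - 1) + (k : ℚ) - 1
    else
      -- 1-based index `m+1 = 2i` is even, with `i = (m+1)/2`
      2 * (((m.val + 1) / 2 : ℕ) : ℚ) * ((k : ℚ) - (((m.val + 1) / 2 : ℕ) : ℚ))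

theorem cartan_aux (n : ℕ) (f : ℕ → ℚ) (h0 : f 0 = 0) (h1 : f (n + 1) = 0) (i : Fin n) :
    (cartanA n).mulVec (fun j => f (j.val + 1)) i
      = 2 * f (i.val + 1) - f i.val - f (i.val + 2) := by
  have hi := i.isLt
  have e : (cartanA n).mulVec (fun j => f (j.val + 1)) i
      = ∑ j : Fin n, (fun j : ℕ => (if j = i.val then 2 * f (j + 1) else 0)
        - (if j = i.val + 1 then f (j + 1) else 0)
        - (if j + 1 = i.val then f (j + 1) else 0)) j.val := by
    simp only [Matrix.mulVec, dotProduct, cartanA, Matrix.of_apply]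
    refine Finset.sum_congr rfl fun j _ => ?_
    simp only [Fin.ext_iff]
    split_ifs <;> first | omega | ring
  rw [e, Fin.sum_univ_eq_sum_range (fun j : ℕ => (if j = i.val then 2 * f (j + 1) else 0)
        - (if j = i.val + 1 then f (j + 1) else 0)
        - (if j + 1 = i.val then f (j + 1) else 0)) n, Finset.sum_sub_distrib, Finset.sum_sub_distrib]
  have a1 : ∑ j ∈ Finset.range n, (if j = i.val then 2 * f (j + 1) else 0)
      = 2 * f (i.val + 1) := by
    rw [Finset.sum_ite_eq']
    simp
  have a2 : ∑ j ∈ Finset.range n, (if j = i.val + 1 then f (j + 1) else 0)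
      = f (i.val + 2) := by
    rw [Finset.sum_ite_eq']
    split_ifs with h
    · rfl
    · have : i.val + 2 = n + 1 := by
        simp at h
        omega
      rw [this, h1]
  have a3 : ∑ j ∈ Finset.range n, (if j + 1 = i.val then f (j + 1) else 0)
      = f i.val := by
    rcases hv : i.val with _ | m
    · simp [h0]
    · simp only [Nat.add_right_cancel_iff]
      rw [Finset.sum_ite_eq', if_pos]
      simp
      omega
  rw [a1, a2, a3]
  ring

theorem cartan_unit (n : ℕ) : IsUnit (cartanA n) := by
  rw [← Matrix.mulVec_injective_iff_isUnit]
  refine (injective_iff_map_eq_zero (Matrix.mulVecLin (cartanA n))).2 ?_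
  intro v hv
  let f : ℕ → ℚ := fun m => if h : 0 < m ∧ m - 1 < n then v ⟨m - 1, h.2⟩ else 0
  have hf : v = fun j : Fin n => f (j.val + 1) := by
    funext j
    simp [f]
  have h0 : f 0 = 0 := by simp [f]
  have h1 : f (n + 1) = 0 := by simp [f]
  have key : ∀ i, i < n → 2 * f (i + 1) - f i - f (i + 2) = 0 := by
    intro i hi
    rw [← cartan_aux n f h0 h1 ⟨i, hi⟩, ← hf]
    exact congrFun hv _
  have lin : ∀ m, m ≤ n → f m = m * f 1 ∧ f (m + 1) = (m + 1) * f 1 := by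
    intro m
    induction m with
    | zero => intro _; simp [h0]
    | succ m ih =>
      intro hm
      obtain ⟨p, q⟩ := ih (by omega)
      have := key m (by omega)
      push_cast
      refine ⟨q, ?_⟩
      show f (m + 2) = _
      linarith
  have hl := (lin n le_rfl).2
  rw [h1] at hl
  have hz : f 1 = 0 := by
    rcases mul_eq_zero.1 hl.symm with h | h
    · exact absurd h (by positivity)
    · exact h
  rw [hf]
  funext j
  show f (j.val + 1) = 0
  rw [(lin j.val j.isLt.le).2, hz, mul_zero]

theorem deg_eq (k n : ℕ) (hk : 2 ≤ k) (hn : n = 2 * k - 1) :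
    (cartanA n).mulVec (degSUstar k n) = (2 : ℚ) • satakeAII n := by
  let f : ℕ → ℚ := fun m => if m % 2 = 0 then (m : ℚ) * (k - m / 2)
    else ((2 * k - m - 1) * (m - 1) / 2 + k - 1 : ℚ)
  have hf : degSUstar k n = fun j : Fin n => f (j.val + 1) := by
    funext j
    simp only [degSUstar, f]
    rcases Nat.even_or_odd' j.val with ⟨a, h | h⟩
    · rw [h, if_pos (by omega), if_neg (by omega), show 2 * a / 2 = a by omega]
      push_cast
      ring
    · rw [h, if_neg (by omega), if_pos (by omega), show (2 * a + 1 + 1) / 2 = a + 1 by omega]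
      push_cast
      ring
  have h0 : f 0 = 0 := by simp [f]
  have h1 : f (n + 1) = 0 := by
    have : n + 1 = 2 * k := by omega
    rw [this]
    simp [f]
  funext i
  rw [hf, cartan_aux n f h0 h1 i]
  simp only [f, satakeAII, Pi.smul_apply, smul_eq_mul]
  rcases Nat.even_or_odd' i.val with ⟨a, h | h⟩
  · rw [h, if_neg (by omega), if_pos (by omega), if_pos (by omega), if_neg (by omega)]
    push_cast
    ring
  · rw [h, if_pos (by omega), if_neg (by omega), if_neg (by omega), if_pos (by omega)]
    push_cast
    ring

theorem iwasawa_degrees_SUstar (k : ℕ) (hk : 2 ≤ k) (n : ℕ) (hn : n = 2 * k - 1) :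
    (cartanA n).mulVec (degSUstar k n) = (2 : ℚ) • satakeAII n ∧
      degSUstar k n = (2 : ℚ) • (cartanA n)⁻¹.mulVec (satakeAII n) := by
  have h := deg_eq k n hk hn
  refine ⟨h, ?_⟩
  have hu := (Matrix.isUnit_iff_isUnit_det _).1 (cartan_unit n)
  rw [← Matrix.mulVec_smul, ← h, Matrix.mulVec_mulVec, Matrix.nonsing_inv_mul _ hu,
    Matrix.one_mulVec]
end

section
/- Let p, q be integers with 1 ≤ p < q, set n = p+q, and let ε ∈ ℚⁿ be the vector with ε_j = 1 if j is even and j ≤ 2p, and ε_j = 0 otherwise. Then the vector d ∈ ℚⁿ with entries d_{2i−1} = 2(2i−1)(p+1) − 2i² and d_{2i} = 2i(2p−i+1) for 1 ≤ i ≤ p, and d_m = 2p(p+1) for 2p+1 ≤ m ≤ n, satisfies C·d = 2·ε, where C is the Cartan matrix of type C_n; equivalently d = 2·C⁻¹·ε. Thus d is the vector of degrees of the Iwasawa polynomials of the symmetric space USp(2p,2q)/(USp(2p)×USp(2q)) in the fundamental representations. -/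
open Matrix

/-- The Cartan matrix of type `Cₙ` (last simple root long). -/
def cartanC (n : ℕ) : Matrix (Fin n) (Fin n) ℚ :=
  Matrix.of fun i j =>
    if i = j then 2
    else if j.val = i.val + 1 then -1
    else if i.val = j.val + 1 then (if j.val + 2 = n then -2 else -1)
    else 0

/-- The Satake vector of `USp(2p,2q)/(USp(2p)×USp(2q))` with `p < q` (type CIIₐ):
`εⱼ = 1` iff `j` is even and `j ≤ 2p` (1-based indices as `Fin (p+q)`). -/
def satakeCII (p n : ℕ) : Fin n → ℚ :=
  fun m => if (m.val + 1) % 2 = 0 ∧ m.val + 1 ≤ 2 * p then 1 else 0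

/-- The degrees of the Iwasawa polynomials of `USp(2p,2q)/(USp(2p)×USp(2q))` in the
fundamental representations: `d_{2i-1} = 2(2i-1)(p+1) - 2i²` and `d_{2i} = 2i(2p-i+1)`
for `1 ≤ i ≤ p`, and `d_m = 2p(p+1)` for `2p+1 ≤ m ≤ p+q`. -/
def degUSppq (p n : ℕ) : Fin n → ℚ :=
  fun m =>
    if m.val + 1 ≤ 2 * p then
      if m.val % 2 = 0 then
        -- 1-based index `m+1 = 2i-1` is odd, with `i = m/2 + 1`
        2 * (2 * (((m.val / 2 : ℕ) : ℚ) + 1) - 1) * ((p : ℚ) + 1) -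
          2 * (((m.val / 2 : ℕ) : ℚ) + 1) ^ 2
      else
        -- 1-based index `m+1 = 2i` is even, with `i = (m+1)/2`
        2 * (((m.val + 1) / 2 : ℕ) : ℚ) * (2 * (p : ℚ) - (((m.val + 1) / 2 : ℕ) : ℚ) + 1)
    else 2 * (p : ℚ) * ((p : ℚ) + 1)

theorem cartanC_row (n : ℕ) (i : Fin n) (f : ℕ → ℚ) :
    (cartanC n).mulVec (fun j => f j.val) i =
      2 * f i.val - (if i.val + 1 < n then f (i.val + 1) else 0)
        - (if i.val = 0 then 0 else (if i.val + 1 = n then 2 else 1) * f (i.val - 1)) := by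
  obtain ⟨i, hi⟩ := i
  have h1 : (cartanC n).mulVec (fun j => f j.val) ⟨i, hi⟩ =
      ∑ j : Fin n, (fun k : ℕ => (if k = i then 2 * f i else 0) +
        (if k = i + 1 then - f (i + 1) else 0) +
        (if k = i - 1 then (if i = 0 then 0 else
          -((if i + 1 = n then 2 else 1) * f (i - 1))) else 0)) j.val := by
    unfold Matrix.mulVec dotProduct
    apply Finset.sum_congr rfl
    rintro ⟨j, hj⟩ -
    simp only [cartanC, Matrix.of_apply, Fin.mk.injEq]
    by_cases a : j = i
    · subst a
      have : ¬ (j = j - 1 ∧ j ≠ 0) := by omega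
      by_cases b : j = 0
      · simp [b]
      · have : ¬ (j = j - 1) := by omega
        simp [this]
    · by_cases b : j = i + 1
      · subst b
        have : ¬ (i + 1 = i - 1) := by omega
        simp [this]
      · by_cases c : i = j + 1
        · subst c
          have e : (j + 2 = n) ↔ (j + 1 + 1 = n) := by omega
          have e1 : ¬ (j + 1 = j) := by omega
          have e2 : ¬ (j = j + 1 + 1) := by omega
          simp only [e, e1, e2]
          by_cases g : j + 1 + 1 = n <;> simp [g]
        · have e1 : ¬ (i = j) := by omega
          by_cases g : i = 0
          · subst g
            have e3 : ¬ (j = 0 + 1) := b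
            simp only [a, e3, c, e1, if_false, if_true, ite_self]
            ring
          · have e2 : ¬ (j = i - 1) := by omega
            simp [a, b, c, e1, e2]
  have h2 : i - 1 < n := by omega
  rw [h1, Fin.sum_univ_eq_sum_range (fun k : ℕ => (if k = i then 2 * f i else 0) +
        (if k = i + 1 then - f (i + 1) else 0) +
        (if k = i - 1 then (if i = 0 then 0 else
          -((if i + 1 = n then 2 else 1) * f (i - 1))) else 0)) n, Finset.sum_add_distrib, Finset.sum_add_distrib,
    Finset.sum_ite_eq', Finset.sum_ite_eq', Finset.sum_ite_eq']
  simp only [Finset.mem_range, hi, h2, if_true]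
  split_ifs <;> ring

theorem cartanC_inj (n : ℕ) (x : Fin n → ℚ) (hx : (cartanC n).mulVec x = 0) : x = 0 := by
  obtain ⟨f, rfl⟩ : ∃ f : ℕ → ℚ, x = fun j => f j.val :=
    ⟨fun k => if h : k < n then x ⟨k, h⟩ else 0, by ext j; simp⟩
  have row : ∀ i, i < n → 2 * f i - (if i + 1 < n then f (i + 1) else 0)
        - (if i = 0 then 0 else (if i + 1 = n then 2 else 1) * f (i - 1)) = 0 := by
    intro i hi
    have := congrFun hx ⟨i, hi⟩
    rwa [cartanC_row] at this
  have key : ∀ k, (k < n → f k = (k + 1) * f 0) ∧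
      (k + 1 < n → f (k + 1) = (k + 2) * f 0) := by
    intro k
    induction k with
    | zero =>
      refine ⟨fun _ => by simp, fun h => ?_⟩
      have := row 0 (by omega)
      simp only [h, if_true] at this
      push_cast
      linarith
    | succ k ih =>
      refine ⟨fun h => by rw [ih.2 h]; push_cast; ring, fun h => ?_⟩
      have := row (k + 1) (by omega)
      have e : ¬ (k + 1 + 1 = n) := by omega
      simp only [h, if_true, e, if_false, Nat.add_sub_cancel, Nat.succ_ne_zero] at this
      rw [ih.2 (by omega), ih.1 (by omega)] at this
      push_cast
      linarith
  have f0 : 0 < n → f 0 = 0 := by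
    intro h
    obtain ⟨m, rfl⟩ : ∃ m, n = m + 1 := ⟨n - 1, by omega⟩
    have r := row m (by omega)
    rcases m with _ | m
    · simpa using r
    · simp at r
      rw [(key m).1 (by omega), (key m).2 (by omega)] at r
      linarith
  ext j
  have := (key j.val).1 j.isLt
  simp [this, f0 (by have := j.isLt; omega)]

theorem cartanC_deg (p q : ℕ) (hp : 1 ≤ p) (hpq : p < q) (n : ℕ) (hn : n = p + q) :
    (cartanC n).mulVec (degUSppq p n) = (2 : ℚ) • satakeCII p n := by
  obtain ⟨g, hg⟩ : ∃ g : ℕ → ℚ, g = fun m => if m + 1 ≤ 2 * p then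
      if m % 2 = 0 then
        2 * (2 * (((m / 2 : ℕ) : ℚ) + 1) - 1) * ((p : ℚ) + 1) -
          2 * (((m / 2 : ℕ) : ℚ) + 1) ^ 2
      else
        2 * (((m + 1) / 2 : ℕ) : ℚ) * (2 * (p : ℚ) - (((m + 1) / 2 : ℕ) : ℚ) + 1)
    else 2 * (p : ℚ) * ((p : ℚ) + 1) := ⟨_, rfl⟩
  have hd : degUSppq p n = fun j => g j.val := by subst hg; rfl
  have g0 : ∀ k, k < p → g (2 * k) = 2 * (2 * ((k : ℚ) + 1) - 1) * ((p : ℚ) + 1) -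
          2 * ((k : ℚ) + 1) ^ 2 := by
    intro k hk
    have e1 : 2 * k + 1 ≤ 2 * p := by omega
    have e2 : 2 * k % 2 = 0 := by omega
    have e3 : 2 * k / 2 = k := by omega
    simp only [hg, e1, e2, e3, if_true]
  have g1 : ∀ k, k < p → g (2 * k + 1) = 2 * ((k : ℚ) + 1) * (2 * p - (k + 1) + 1) := by
    intro k hk
    have e1 : 2 * k + 1 + 1 ≤ 2 * p := by omega
    have e2 : ¬ ((2 * k + 1) % 2 = 0) := by omega
    have e3 : (2 * k + 1 + 1) / 2 = k + 1 := by omega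
    simp only [hg, e1, e2, e3, if_true, if_false]
    push_cast
    ring
  have g2 : ∀ m, 2 * p ≤ m + 1 → g m = 2 * (p : ℚ) * ((p : ℚ) + 1) := by
    intro m hm
    by_cases h : m + 1 = 2 * p
    · obtain ⟨k, rfl⟩ : ∃ k, p = k + 1 := ⟨p - 1, by omega⟩
      obtain rfl : m = 2 * k + 1 := by omega
      rw [g1 k (by omega)]
      push_cast
      ring
    · have : ¬ (m + 1 ≤ 2 * p) := by omega
      simp only [hg, this, if_false]
  ext ⟨i, hi⟩
  rw [hd, cartanC_row]
  simp only [Pi.smul_apply, satakeCII, smul_eq_mul]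
  by_cases h : 2 * p ≤ i
  · have e : ¬ (i + 1 ≤ 2 * p) := by omega
    have e0 : ¬ (i = 0) := by omega
    rw [g2 i (by omega), g2 (i + 1) (by omega), g2 (i - 1) (by omega)]
    simp only [e, e0, and_false, if_false]
    by_cases l : i + 1 = n
    · have : ¬ (i + 1 < n) := by omega
      simp only [l, if_true, lt_irrefl, if_false]
      ring
    · have : i + 1 < n := by omega
      simp only [l, this, if_true, if_false]
      ring
  · have l : i + 1 < n := by omega
    have l' : ¬ (i + 1 = n) := by omega
    simp only [l, l', if_true, if_false]
    obtain ⟨k, hk | hk⟩ : ∃ k, i = 2 * k ∨ i = 2 * k + 1 := ⟨i / 2, by omega⟩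
    · subst hk
      have e : ¬ ((2 * k + 1) % 2 = 0) := by omega
      rw [g0 k (by omega), g1 k (by omega)]
      simp only [e, false_and, if_false]
      rcases k with _ | k
      · simp
        ring
      · have e1 : ¬ (2 * (k + 1) = 0) := by omega
        have e2 : 2 * (k + 1) - 1 = 2 * k + 1 := by omega
        simp only [e1, if_false, e2]
        rw [g1 k (by omega)]
        push_cast
        ring
    · subst hk
      have e : (2 * k + 1 + 1) % 2 = 0 := by omega
      have e1 : 2 * k + 1 + 1 ≤ 2 * p := by omega
      simp only [e, e1, and_self, if_true, Nat.succ_ne_zero, if_false, Nat.add_sub_cancel]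
      rw [g0 k (by omega), g1 k (by omega)]
      by_cases hk : k + 1 < p
      · rw [show 2 * k + 1 + 1 = 2 * (k + 1) by ring, g0 (k + 1) hk]
        push_cast
        ring
      · obtain rfl : p = k + 1 := by omega
        rw [g2 _ (by omega)]
        push_cast
        ring

theorem iwasawa_degrees_USppq (p q : ℕ) (hp : 1 ≤ p) (hpq : p < q) (n : ℕ)
    (hn : n = p + q) :
    (cartanC n).mulVec (degUSppq p n) = (2 : ℚ) • satakeCII p n ∧
      degUSppq p n = (2 : ℚ) • (cartanC n)⁻¹.mulVec (satakeCII p n) := by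
  have h := cartanC_deg p q hp hpq n hn
  refine ⟨h, ?_⟩
  have hu : IsUnit (cartanC n).det := by
    rw [isUnit_iff_ne_zero]
    intro h0
    obtain ⟨v, hv, hv'⟩ := Matrix.exists_mulVec_eq_zero_iff.mpr h0
    exact hv (cartanC_inj n v hv')
  rw [← Matrix.mulVec_smul, ← h, Matrix.mulVec_mulVec, Matrix.nonsing_inv_mul _ hu,
    Matrix.one_mulVec]
end
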